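/- Let G be a gyrogroup and H a subgyrogroup of G with [G : H] = p, where p is a prime. The following are equivalent: (1) for every a ∈ G∖H, pa ∈ H; (2) for every a ∈ G∖H, there is a positive integer n (depending on a) having no prime divisor less than p such that na ∈ H; (3) for every a ∈ G∖H, none of a, 2a, …, (p−1)a lies in H. -/

import Mathlib

universe u v

/-- A gyrogroup: a groupoid `(G, +)` with a left identity `0`, left inverses `-a`,
gyroautomorphisms `gyr a b` (automorphisms of `(G, +)`) satisfying the left
gyroassociative law, and the left loop property. -/
class Gyrogroup (G : Type u) extends Add G, Zero G, Neg G where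
  /-- (G1) left identity -/
  zero_add' : ∀ a : G, 0 + a = a
  /-- (G2) left inverse -/
  neg_add' : ∀ a : G, -a + a = 0
  /-- (G3) the gyroautomorphisms, as bijections of `G` -/
  gyr : G → G → G ≃ G
  /-- (G3) each `gyr a b` preserves the operation, i.e. is an automorphism -/
  gyr_add' : ∀ a b x y : G, gyr a b (x + y) = gyr a b x + gyr a b y
  /-- (G3) left gyroassociative law -/
  add_gyr_assoc' : ∀ a b c : G, a + (b + c) = (a + b) + gyr a b c
  /-- (G4) left loop property -/
  left_loop' : ∀ a b : G, gyr (a + b) b = gyr a b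

open Gyrogroup

variable {G : Type u}

/-- A subgyrogroup: a nonempty subset closed under the operation and inverses. -/
structure IsSubgyrogroup [Gyrogroup G] (H : Set G) : Prop where
  nonempty : H.Nonempty
  add_mem : ∀ ⦃a : G⦄, a ∈ H → ∀ ⦃b : G⦄, b ∈ H → a + b ∈ H
  neg_mem : ∀ ⦃a : G⦄, a ∈ H → -a ∈ H

/-- A gyrogroup homomorphism: a map preserving the operation. -/
def IsGyroHom [Gyrogroup G] {A : Type v} [Gyrogroup A] (φ : G → A) : Prop :=
  ∀ x y : G, φ (x + y) = φ x + φ y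

/-- The kernel of a map into a gyrogroup. -/
def gyroKer [Gyrogroup G] {A : Type v} [Gyrogroup A] (φ : G → A) : Set G :=
  {x : G | φ x = 0}

/-- A normal subgyrogroup: the kernel of some gyrogroup homomorphism from `G`. -/
def IsNormalSubgyrogroup [Gyrogroup G] (N : Set G) : Prop :=
  IsSubgyrogroup N ∧ ∃ (A : Type u) (instA : Gyrogroup A) (φ : G → A),
    @IsGyroHom G _ A instA φ ∧ N = @gyroKer G _ A instA φ

/-- The gyrocommutator `[a, b] = -(a + b) + gyr a b (b + a)`. -/
def gyroCommutator [Gyrogroup G] (a b : G) : G :=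
  -(a + b) + gyr a b (b + a)

/-- The set of all gyrocommutators of `G`. -/
def gyroCommutatorSet (G : Type u) [Gyrogroup G] : Set G :=
  {x : G | ∃ a b : G, x = gyroCommutator a b}

/-- `K` is the commutator subgyrogroup `G'` of `G`: the smallest subgyrogroup
containing all commutators. -/
def IsCommutatorSubgyrogroup [Gyrogroup G] (K : Set G) : Prop :=
  IsSubgyrogroup K ∧ gyroCommutatorSet G ⊆ K ∧
    ∀ H : Set G, IsSubgyrogroup H → gyroCommutatorSet G ⊆ H → K ⊆ H

/-- `K` is the normal closure `⟨⟨A⟩⟩` of `A`: the smallest normal subgyrogroup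
containing `A`. -/
def IsGyroNormalClosure [Gyrogroup G] (A K : Set G) : Prop :=
  IsNormalSubgyrogroup K ∧ A ⊆ K ∧
    ∀ N : Set G, IsNormalSubgyrogroup N → A ⊆ N → K ⊆ N

/-- The left coset `a ⊕ H`. -/
def lcoset [Gyrogroup G] (a : G) (H : Set G) : Set G := (a + ·) '' H

/-- The right coset `H ⊕ a`. -/
def rcoset [Gyrogroup G] (H : Set G) (a : G) : Set G := (· + a) '' H

/-- A gyrogroup is gyrocommutative if `a + b = gyr a b (b + a)` for all `a, b`. -/
def IsGyrocommutative (G : Type u) [Gyrogroup G] : Prop :=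
  ∀ a b : G, a + b = gyr a b (b + a)

/-- An L-subgyrogroup: a subgyrogroup with `gyr a h (H) = H` for all `a ∈ G`, `h ∈ H`. -/
def IsLSubgyrogroup [Gyrogroup G] (H : Set G) : Prop :=
  IsSubgyrogroup H ∧ ∀ a : G, ∀ h ∈ H, ⇑(gyr a h) '' H = H

/-- A subgroup of a gyrogroup: a subgyrogroup that forms a group under the gyrogroup
operation (equivalently, on which the operation is associative; together with the
closure properties and the identity and inverses inherited from `G`, this makes it
a group). -/
def IsSubgroupOfGyrogroup [Gyrogroup G] (H : Set G) : Prop :=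
  IsSubgyrogroup H ∧ ∀ a ∈ H, ∀ b ∈ H, ∀ c ∈ H, a + (b + c) = (a + b) + c

/-- The left nucleus of `G`. -/
def leftNucleus (G : Type u) [Gyrogroup G] : Set G :=
  {a : G | ∀ b c : G, a + (b + c) = (a + b) + c}

/-- The middle nucleus of `G`. -/
def middleNucleus (G : Type u) [Gyrogroup G] : Set G :=
  {b : G | ∀ a c : G, a + (b + c) = (a + b) + c}

/-- The right nucleus of `G`. -/
def rightNucleus (G : Type u) [Gyrogroup G] : Set G :=
  {c : G | ∀ a b : G, a + (b + c) = (a + b) + c}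

/-- `L(G)`: the set of left gyrotranslations of `G`, viewed as permutations of `G`.
A permutation `σ` is a left gyrotranslation when `σ x = a + x` for some fixed `a`. -/
def LSet (G : Type u) [Gyrogroup G] : Set (Equiv.Perm G) :=
  {σ : Equiv.Perm G | ∃ a : G, ∀ x : G, σ x = a + x}

/-- `L(H)` for a subset `H ⊆ G`: the left gyrotranslations by elements of `H`. -/
def LSetOf [Gyrogroup G] (H : Set G) : Set (Equiv.Perm G) :=
  {σ : Equiv.Perm G | ∃ a ∈ H, ∀ x : G, σ x = a + x}

/-- The left multiplication group `LMlt(G)`: the subgroup of `Sym(G)` generated by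
the left gyrotranslations. -/
def LMlt (G : Type u) [Gyrogroup G] : Subgroup (Equiv.Perm G) :=
  Subgroup.closure (LSet G)

/-- `L(G)'`: the set of products `L_{a₁} ∘ ⋯ ∘ L_{aₙ}` of left gyrotranslations whose
reversed product `L_{aₙ} ∘ ⋯ ∘ L_{a₁}` is the identity. -/
def LPrime (G : Type u) [Gyrogroup G] : Set (Equiv.Perm G) :=
  {σ : Equiv.Perm G | ∃ l : List (Equiv.Perm G),
    (∀ τ ∈ l, τ ∈ LSet G) ∧ σ = l.prod ∧ l.reverse.prod = 1}

/-- `L(G)^# = ⋂_{a ∈ G} L_a ∘ L(G)`. -/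
def LSharp (G : Type u) [Gyrogroup G] : Set (Equiv.Perm G) :=
  {σ : Equiv.Perm G | ∀ ρ ∈ LSet G, ∃ τ ∈ LSet G, σ = ρ * τ}

/-- The radical of `G`: elements whose left gyrotranslation lies in `L(G)'`. -/
def gyroRadical (G : Type u) [Gyrogroup G] : Set G :=
  {a : G | ∃ σ ∈ LPrime G, ∀ x : G, σ x = a + x}

/-- `X` is a normal subgroup of the subgroup `Γ` (as a subset of the ambient group). -/
def IsNormalSubgroupIn {M : Type v} [Group M] (Γ : Subgroup M) (X : Set M) : Prop :=
  X ⊆ (Γ : Set M) ∧ (1 : M) ∈ X ∧ (∀ σ ∈ X, σ⁻¹ ∈ X) ∧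
    (∀ σ ∈ X, ∀ τ ∈ X, σ * τ ∈ X) ∧ ∀ γ ∈ Γ, ∀ σ ∈ X, γ * σ * γ⁻¹ ∈ X

/-- The coaddition `a ⊞ b = a + gyr a (-b) b`. -/
def gyroCoadd [Gyrogroup G] (a b : G) : G := a + gyr a (-b) b

/-- Natural-number multiples: `0 • a = 0`, `(m+1) • a = a + m • a`. -/
def gyroNsmul [Gyrogroup G] : ℕ → G → G
  | 0, _ => 0
  | n + 1, a => a + gyroNsmul n a

/-- The index `[G : H]`: the number of left cosets of `H` in `G`. -/
noncomputable def gyroIndex [Gyrogroup G] (H : Set G) : ℕ :=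
  Set.ncard {S : Set G | ∃ a : G, S = lcoset a H}

namespace Gyrogroup

theorem left_cancel [Gyrogroup G] {a b c : G} (h : a + b = a + c) : b = c := by
  have h' := congrArg (-a + ·) h
  simpa [add_gyr_assoc', neg_add', zero_add'] using h'

theorem gyr_zero_left [Gyrogroup G] (b c : G) : gyr 0 b c = c := by
  have h := add_gyr_assoc' 0 b c
  rw [zero_add', zero_add'] at h
  exact (left_cancel h).symm

theorem left_inverse_property [Gyrogroup G] (a b : G) : -a + (a + b) = b := by
  rw [add_gyr_assoc', ← left_loop', neg_add', gyr_zero_left, zero_add']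

theorem add_zero' [Gyrogroup G] (a : G) : a + 0 = a :=
  left_cancel (a := -a) (by rw [left_inverse_property, neg_add'])

theorem gyroNsmul_eq_iterate [Gyrogroup G] (n : ℕ) (a : G) :
    gyroNsmul n a = (a + ·)^[n] 0 := by
  induction n with
  | zero => rfl
  | succ n ih => rw [Function.iterate_succ_apply', ← ih, gyroNsmul]

theorem gyroNsmul_one [Gyrogroup G] (a : G) : gyroNsmul 1 a = a :=
  add_zero' a

/-- The left power alternative property. -/
theorem gyroNsmul_add_eq_iterate [Gyrogroup G] (n : ℕ) (a x : G) :
    gyroNsmul n a + x = (a + ·)^[n] x := by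
  suffices h : (∀ c, gyr (gyroNsmul n a) a c = c) ∧
      ∀ x, gyroNsmul n a + x = (a + ·)^[n] x from h.2 x
  induction n with
  | zero => exact ⟨gyr_zero_left a, zero_add'⟩
  | succ n ih =>
    have hs : gyroNsmul (n + 1) a = gyroNsmul n a + a := by
      rw [ih.2, gyroNsmul_eq_iterate, Function.iterate_succ_apply, add_zero']
    refine ⟨fun c => ?_, fun x => ?_⟩
    · rw [hs, left_loop', ih.1]
    · rw [Function.iterate_succ_apply, ← ih.2, add_gyr_assoc', ih.1, hs]

theorem gyroNsmul_add_assoc [Gyrogroup G] (m n : ℕ) (a x : G) :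
    gyroNsmul (m + n) a + x = gyroNsmul m a + (gyroNsmul n a + x) := by
  simp only [gyroNsmul_add_eq_iterate, Function.iterate_add_apply]

theorem add_gyroNsmul [Gyrogroup G] (m n : ℕ) (a : G) :
    gyroNsmul (m + n) a = gyroNsmul m a + gyroNsmul n a := by
  simpa only [add_zero'] using gyroNsmul_add_assoc m n a 0

end Gyrogroup

namespace IsSubgyrogroup

theorem zero_mem [Gyrogroup G] {H : Set G} (hH : IsSubgyrogroup H) : (0 : G) ∈ H := by
  obtain ⟨h, hh⟩ := hH.nonempty
  exact neg_add' h ▸ hH.add_mem (hH.neg_mem hh) hh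

theorem mem_of_add_mem [Gyrogroup G] {H : Set G} (hH : IsSubgyrogroup H) {a b : G}
    (ha : a ∈ H) (hab : a + b ∈ H) : b ∈ H :=
  left_inverse_property a b ▸ hH.add_mem (hH.neg_mem ha) hab

theorem gyroNsmul_mul_mem [Gyrogroup G] {H : Set G} (hH : IsSubgyrogroup H) {a : G} {m : ℕ}
    (hm : gyroNsmul m a ∈ H) (k : ℕ) : gyroNsmul (m * k) a ∈ H := by
  induction k with
  | zero => exact hH.zero_mem
  | succ k ih => exact Nat.mul_succ m k ▸ add_gyroNsmul (m * k) m a ▸ hH.add_mem ih hm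

theorem gyroNsmul_gcd_mem [Gyrogroup G] {H : Set G} (hH : IsSubgyrogroup H) {a : G} (m n : ℕ)
    (hm : gyroNsmul m a ∈ H) (hn : gyroNsmul n a ∈ H) : gyroNsmul (m.gcd n) a ∈ H := by
  induction m, n using Nat.gcd.induction with
  | H0 n => rwa [Nat.gcd_zero_left]
  | H1 m n _ ih =>
    rw [Nat.gcd_rec]
    refine ih (hH.mem_of_add_mem (hH.gyroNsmul_mul_mem hm (n / m)) ?_) hm
    rwa [← add_gyroNsmul, Nat.div_add_mod]

theorem gyroNsmul_mem_of_lcoset_eq [Gyrogroup G] {H : Set G} (hH : IsSubgyrogroup H) {a : G}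
    {m k : ℕ} (h : lcoset (gyroNsmul (m + k) a) H = lcoset (gyroNsmul m a) H) :
    gyroNsmul k a ∈ H := by
  have hmem : gyroNsmul (m + k) a ∈ lcoset (gyroNsmul m a) H :=
    h ▸ ⟨0, hH.zero_mem, add_zero' _⟩
  obtain ⟨x, hx, hxe⟩ := hmem
  rw [add_gyroNsmul] at hxe
  exact left_cancel hxe ▸ hx

/-- If the index is finite, some positive multiple of `a`, at most the index, lies in `H`. -/
theorem exists_gyroNsmul_mem [Gyrogroup G] {H : Set G} (hH : IsSubgyrogroup H)
    (hidx : gyroIndex H ≠ 0) (a : G) :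
    ∃ k, 1 ≤ k ∧ k ≤ gyroIndex H ∧ gyroNsmul k a ∈ H := by
  have hfin : {S : Set G | ∃ a : G, S = lcoset a H}.Finite := Set.finite_of_ncard_ne_zero hidx
  obtain ⟨i, hi, j, hj, hij, he⟩ := Set.exists_ne_map_eq_of_ncard_lt_of_maps_to
    (s := (Finset.range (gyroIndex H + 1) : Set ℕ)) (t := {S : Set G | ∃ a : G, S = lcoset a H})
    (f := fun i => lcoset (gyroNsmul i a) H)
    (by rw [Set.ncard_coe_finset, Finset.card_range]; exact Nat.lt_succ_self _)
    (fun i _ => ⟨_, rfl⟩) hfin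
  simp only [Finset.coe_range, Set.mem_Iio] at hi hj
  wlog hlt : i < j generalizing i j
  · exact this j i hij.symm he.symm hj hi (by omega)
  obtain ⟨k, rfl⟩ := Nat.exists_eq_add_of_lt hlt
  exact ⟨k + 1, by omega, by omega, hH.gyroNsmul_mem_of_lcoset_eq he.symm⟩

end IsSubgyrogroup

/-- for a subgyrogroup `H` of prime index `p`, the following are
equivalent: (1) `pa ∈ H` for all `a ∉ H`; (2) for each `a ∉ H` there is `n > 0`
with no prime divisor less than `p` such that `na ∈ H`; (3) for each `a ∉ H`,
none of `a, 2a, …, (p-1)a` lies in `H`. -/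
theorem subgyrogroup_prime_index_tfae [Gyrogroup G] (H : Set G)
    (hH : IsSubgyrogroup H) (p : ℕ) (hp : p.Prime) (hidx : gyroIndex H = p) :
    ((∀ a : G, a ∉ H → gyroNsmul p a ∈ H) ↔
      (∀ a : G, a ∉ H → ∃ n : ℕ, 0 < n ∧
        (∀ q : ℕ, q.Prime → q ∣ n → p ≤ q) ∧ gyroNsmul n a ∈ H)) ∧
    ((∀ a : G, a ∉ H → ∃ n : ℕ, 0 < n ∧
        (∀ q : ℕ, q.Prime → q ∣ n → p ≤ q) ∧ gyroNsmul n a ∈ H) ↔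
      (∀ a : G, a ∉ H → ∀ i : ℕ, 1 ≤ i → i ≤ p - 1 → gyroNsmul i a ∉ H)) := by
  have h12 : (∀ a : G, a ∉ H → gyroNsmul p a ∈ H) →
      ∀ a : G, a ∉ H → ∃ n : ℕ, 0 < n ∧
        (∀ q : ℕ, q.Prime → q ∣ n → p ≤ q) ∧ gyroNsmul n a ∈ H := fun h a ha =>
    ⟨p, hp.pos, fun q hq hqp => ((Nat.prime_dvd_prime_iff_eq hq hp).1 hqp).ge, h a ha⟩
  have h23 : (∀ a : G, a ∉ H → ∃ n : ℕ, 0 < n ∧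
        (∀ q : ℕ, q.Prime → q ∣ n → p ≤ q) ∧ gyroNsmul n a ∈ H) →
      ∀ a : G, a ∉ H → ∀ i : ℕ, 1 ≤ i → i ≤ p - 1 → gyroNsmul i a ∉ H := by
    intro h a ha i hi hip hmem
    obtain ⟨n, -, hq, hn⟩ := h a ha
    have hco : i.gcd n = 1 := Nat.coprime_of_dvd fun q hqp hqi hqn => by
      have := hq q hqp hqn
      have := Nat.le_of_dvd hi hqi
      omega
    exact ha (by simpa only [hco, gyroNsmul_one] using hH.gyroNsmul_gcd_mem i n hmem hn)
  have h31 : (∀ a : G, a ∉ H → ∀ i : ℕ, 1 ≤ i → i ≤ p - 1 → gyroNsmul i a ∉ H) →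
      ∀ a : G, a ∉ H → gyroNsmul p a ∈ H := by
    intro h a ha
    obtain ⟨k, hk, hkp, hmem⟩ := hH.exists_gyroNsmul_mem (hidx ▸ hp.ne_zero) a
    obtain rfl : k = p := by
      by_contra hne
      exact h a ha k hk (by omega) hmem
    exact hmem
  exact ⟨⟨h12, h31 ∘ h23⟩, ⟨h23, h12 ∘ h31⟩⟩
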